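/- Define K : ℝ⁹ → ℝ⁹ by sending (x_b, x_c, y_c, x_d, y_d, z_d, x_e, y_e, z_e) to the nine pairwise distances among the points A = (0,0,0), B = (x_b, 0, 0), C = (x_c, y_c, 0), D = (x_d, y_d, z_d), E = (x_e, y_e, z_e) in ℝ³ other than dist(D, E), i.e. (|AB|, |AC|, |BC|, |AD|, |BD|, |CD|, |AE|, |BE|, |CE|). At every point where x_b > 0, y_c > 0, z_d ≠ 0, z_e ≠ 0 and all nine of these distances are nonzero, K is differentiable and (the product of the nine distances) · |det(DK)| = x_b² · y_c · 36 · V_{ABCD} · V_{ABCE}, where DK is the derivative of K at that point viewed as a 9×9 matrix and V_{ABCD}, V_{ABCE} are the volumes of the tetrahedra ABCD and ABCE. -/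

import Mathlib

/-- The nine pairwise distances `(|AB|, |AC|, |BC|, |AD|, |BD|, |CD|, |AE|, |BE|, |CE|)`
(i.e. all pairwise distances except `|DE|`) among the points `A = (0,0,0)`, `B = (x_b,0,0)`,
`C = (x_c,y_c,0)`, `D = (x_d,y_d,z_d)`, `E = (x_e,y_e,z_e)` in `ℝ³`, as a map of
`(x_b, x_c, y_c, x_d, y_d, z_d, x_e, y_e, z_e)`. -/
noncomputable def twoTetLengths : (Fin 9 → ℝ) → (Fin 9 → ℝ) := fun v =>
  ![Real.sqrt ((v 0) ^ 2),
    Real.sqrt ((v 1) ^ 2 + (v 2) ^ 2),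
    Real.sqrt ((v 1 - v 0) ^ 2 + (v 2) ^ 2),
    Real.sqrt ((v 3) ^ 2 + (v 4) ^ 2 + (v 5) ^ 2),
    Real.sqrt ((v 3 - v 0) ^ 2 + (v 4) ^ 2 + (v 5) ^ 2),
    Real.sqrt ((v 3 - v 1) ^ 2 + (v 4 - v 2) ^ 2 + (v 5) ^ 2),
    Real.sqrt ((v 6) ^ 2 + (v 7) ^ 2 + (v 8) ^ 2),
    Real.sqrt ((v 6 - v 0) ^ 2 + (v 7) ^ 2 + (v 8) ^ 2),
    Real.sqrt ((v 6 - v 1) ^ 2 + (v 7 - v 2) ^ 2 + (v 8) ^ 2)]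

/-- The coordinates, as linear forms on `ℝ⁹`, of the nine edge vectors whose lengths are the
components of `twoTetLengths`. -/
noncomputable def edgeForm : Fin 9 → Fin 3 → (Fin 9 → ℝ) →L[ℝ] ℝ :=
  let x (j : Fin 9) : (Fin 9 → ℝ) →L[ℝ] ℝ := ContinuousLinearMap.proj j
  ![![x 0, 0, 0],
    ![x 1, x 2, 0],
    ![x 1 - x 0, x 2, 0],
    ![x 3, x 4, x 5],
    ![x 3 - x 0, x 4, x 5],
    ![x 3 - x 1, x 4 - x 2, x 5],
    ![x 6, x 7, x 8],
    ![x 6 - x 0, x 7, x 8],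
    ![x 6 - x 1, x 7 - x 2, x 8]]

theorem twoTetLengths_apply (v : Fin 9 → ℝ) (i : Fin 9) :
    twoTetLengths v i = √(∑ k, (edgeForm i k v) ^ 2) := by
  fin_cases i <;> simp [twoTetLengths, edgeForm, Fin.sum_univ_three]

theorem hasFDerivAt_sqrt_sum_sq {E ι : Type*} [NormedAddCommGroup E] [NormedSpace ℝ E]
    [Fintype ι] (a : ι → E →L[ℝ] ℝ) {x : E} (hx : √(∑ k, (a k x) ^ 2) ≠ 0) :
    HasFDerivAt (fun y => √(∑ k, (a k y) ^ 2))
      ((√(∑ k, (a k x) ^ 2))⁻¹ • ∑ k, a k x • a k) x := by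
  have hsum : HasFDerivAt (fun y => ∑ k, (a k y) ^ 2) (∑ k, (2 * a k x) • a k) x :=
    HasFDerivAt.fun_sum fun k _ => by simpa using (a k).hasFDerivAt.pow (x := x) 2
  convert hsum.sqrt (fun h => hx (by rw [h, Real.sqrt_zero])) using 1
  ext v
  simp only [smul_apply, sum_apply, smul_eq_mul,
    mul_assoc, ← Finset.mul_sum]
  field_simp

theorem hasFDerivAt_twoTetLengths {p : Fin 9 → ℝ} (hp : ∀ i, twoTetLengths p i ≠ 0) :
    HasFDerivAt twoTetLengths
      (ContinuousLinearMap.pi fun i =>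
        (twoTetLengths p i)⁻¹ • ∑ k, edgeForm i k p • edgeForm i k) p := by
  rw [hasFDerivAt_pi']
  intro i
  have hi := hp i
  simp only [twoTetLengths_apply] at hi ⊢
  exact hasFDerivAt_sqrt_sum_sq (edgeForm i) hi

/-- The Jacobian determinant of the halved squared lengths: the Jacobian matrix is block lower
triangular with respect to the coordinates of `B` and `C`, of `D`, and of `E`. -/
theorem det_edgeForm (p : Fin 9 → ℝ) :
    (Matrix.of fun i j : Fin 9 => ∑ k, edgeForm i k p * edgeForm i k (Pi.single j 1)).det =
      ((p 0) ^ 2 * p 2) * (p 0 * p 2 * p 5) * (p 0 * p 2 * p 8) := by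
  let e : (Fin 3 ⊕ Fin 3) ⊕ Fin 3 ≃ Fin 9 :=
    (finSumFinEquiv.sumCongr (Equiv.refl _)).trans finSumFinEquiv
  have heBC (i) : e (.inl (.inl i)) = ![0, 1, 2] i := by fin_cases i <;> rfl
  have heD (i) : e (.inl (.inr i)) = ![3, 4, 5] i := by fin_cases i <;> rfl
  have heE (i) : e (.inr i) = ![6, 7, 8] i := by fin_cases i <;> rfl
  rw [← Matrix.det_submatrix_equiv_self e]
  set M := (Matrix.of fun i j : Fin 9 =>
    ∑ k, edgeForm i k p * edgeForm i k (Pi.single j 1)).submatrix e e with hM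
  have h₁ : M.toBlocks₁₂ = 0 := by
    ext (i | i) j <;> fin_cases i <;> fin_cases j <;>
      simp [hM, heBC, heD, heE, Matrix.toBlocks₁₂, edgeForm, Fin.sum_univ_three,
        Fin.ext_iff]
  have h₂ : M.toBlocks₁₁.toBlocks₁₂ = 0 := by
    ext i j
    fin_cases i <;> fin_cases j <;>
      simp [hM, heBC, heD, Matrix.toBlocks₁₁, Matrix.toBlocks₁₂, edgeForm, Fin.sum_univ_three, Fin.ext_iff]
  have hBC : M.toBlocks₁₁.toBlocks₁₁.det = (p 0) ^ 2 * p 2 := by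
    simp [Matrix.det_fin_three, hM, heBC, Matrix.toBlocks₁₁, edgeForm, Fin.sum_univ_three, Fin.ext_iff]
    ring
  have hD : M.toBlocks₁₁.toBlocks₂₂.det = p 0 * p 2 * p 5 := by
    simp [Matrix.det_fin_three, hM, heD, Matrix.toBlocks₁₁, Matrix.toBlocks₂₂, edgeForm,
      Fin.sum_univ_three, Fin.ext_iff]
    ring
  have hE : M.toBlocks₂₂.det = p 0 * p 2 * p 8 := by
    simp [Matrix.det_fin_three, hM, heE, Matrix.toBlocks₂₂, edgeForm,
      Fin.sum_univ_three, Fin.ext_iff]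
    ring
  rw [← M.fromBlocks_toBlocks, h₁, Matrix.det_fromBlocks_zero₁₂,
    ← M.toBlocks₁₁.fromBlocks_toBlocks, h₂, Matrix.det_fromBlocks_zero₁₂, hBC, hD, hE]

/-- At every point with `x_b > 0`, `y_c > 0`, `z_d ≠ 0`, `z_e ≠ 0` and all nine distances
nonzero, the map `K = twoTetLengths` is differentiable, and
`(∏ of the nine distances) · |det DK| = x_b² · y_c · 36 · V_{ABCD} · V_{ABCE}`, where
`V_{ABCD} = x_b · y_c · |z_d| / 6` and `V_{ABCE} = x_b · y_c · |z_e| / 6` are the volumes of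
the tetrahedra `ABCD` and `ABCE`. -/
theorem twoTetLengths_jacobian (p : Fin 9 → ℝ) (hxb : 0 < p 0) (hyc : 0 < p 2)
    (hzd : p 5 ≠ 0) (hze : p 8 ≠ 0) (hdist : ∀ i, twoTetLengths p i ≠ 0) :
    DifferentiableAt ℝ twoTetLengths p ∧
      (∏ i, twoTetLengths p i) *
          |(Matrix.of fun i j : Fin 9 =>
            fderiv ℝ twoTetLengths p (Pi.single j 1) i).det| =
        (p 0) ^ 2 * p 2 * 36 * (p 0 * p 2 * |p 5| / 6) * (p 0 * p 2 * |p 8| / 6) := by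
  have hK := hasFDerivAt_twoTetLengths hdist
  refine ⟨hK.differentiableAt, ?_⟩
  have hnonneg : 0 ≤ ∏ i, twoTetLengths p i :=
    Finset.prod_nonneg fun i _ => by rw [twoTetLengths_apply]; positivity
  rw [← abs_of_nonneg hnonneg, ← abs_mul, ← Matrix.det_mul_column, hK.fderiv]
  have hM : (Matrix.of fun i j : Fin 9 => twoTetLengths p i *
      (Matrix.of fun i j : Fin 9 => (ContinuousLinearMap.pi fun i =>
        (twoTetLengths p i)⁻¹ • ∑ k, edgeForm i k p • edgeForm i k)
          (Pi.single j (1 : ℝ)) i) i j) =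
      Matrix.of fun i j : Fin 9 => ∑ k, edgeForm i k p * edgeForm i k (Pi.single j 1) := by
    ext i j
    simp [mul_inv_cancel_left₀ (hdist i)]
  rw [hM, det_edgeForm]
  simp only [abs_mul, abs_pow, abs_of_pos hxb, abs_of_pos hyc]
  ring
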